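/- Let w = w_t be the work function at time t ≥ 1 of a 3-server instance on the circle of circumference 2Δ with last request r = r_t, let u be a circle point, and let (x,y,z) ∈ P. If each of w({u,x,ȳ}), w({u,y,z̄}), and w({u,z,x̄}) resolves from u, then Φ*(w, u, x, y, z) ≥ Φ*(w, r, x, y, z). -/

import Mathlib

open Finset

/-- Minimum-matching (Wasserstein) distance between two `k`-point configurations,
represented as `k`-tuples of points. -/
noncomputable def confDist {Ω : Type*} [MetricSpace Ω] {k : ℕ} (X Y : Fin k → Ω) : ℝ :=
  ⨅ σ : Equiv.Perm (Fin k), ∑ i, dist (X i) (Y (σ i))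

/-- The work function at time `t` of the `k`-server instance with initial configuration
`X₀` and requests `r 1, r 2, …` (the value `r 0` is unused): the least cost of serving
the first `t` requests and then moving to the configuration `X`. -/
noncomputable def workFn {Ω : Type*} [MetricSpace Ω] (k : ℕ) (X₀ : Fin k → Ω)
    (r : ℕ → Ω) (t : ℕ) (X : Fin k → Ω) : ℝ :=
  sInf { c : ℝ | ∃ Y : ℕ → Fin k → Ω, Y 0 = X₀ ∧
    (∀ i ∈ Finset.Icc 1 t, ∃ j, Y i j = r i) ∧
    c = (∑ i ∈ Finset.Icc 1 t, confDist (Y (i - 1)) (Y i)) + confDist (Y t) X }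

/-- The offline optimum of the `k`-server instance with initial configuration `X₀`
and requests `r 1, …, r T`. -/
noncomputable def opt {Ω : Type*} [MetricSpace Ω] (k : ℕ) (X₀ : Fin k → Ω)
    (r : ℕ → Ω) (T : ℕ) : ℝ :=
  sInf { c : ℝ | ∃ Y : ℕ → Fin k → Ω, Y 0 = X₀ ∧
    (∀ i ∈ Finset.Icc 1 T, ∃ j, Y i j = r i) ∧
    c = ∑ i ∈ Finset.Icc 1 T, confDist (Y (i - 1)) (Y i) }

/-- `OPT_t(Z)`: the least cost of serving the first `t` requests while ending
in the configuration `Z`. -/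
noncomputable def optTo {Ω : Type*} [MetricSpace Ω] (k : ℕ) (X₀ : Fin k → Ω)
    (r : ℕ → Ω) (t : ℕ) (Z : Fin k → Ω) : ℝ :=
  sInf { c : ℝ | ∃ Y : ℕ → Fin k → Ω, Y 0 = X₀ ∧
    (∀ i ∈ Finset.Icc 1 t, ∃ j, Y i j = r i) ∧ Y t = Z ∧
    c = ∑ i ∈ Finset.Icc 1 t, confDist (Y (i - 1)) (Y i) }

/-- `X 0, X 1, …, X T` is a run of the work function algorithm on the `k`-server
instance with initial configuration `X₀` and requests `r 1, …, r T`. -/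
def IsWFARun {Ω : Type*} [MetricSpace Ω] (k : ℕ) (X₀ : Fin k → Ω)
    (r : ℕ → Ω) (T : ℕ) (X : ℕ → Fin k → Ω) : Prop :=
  X 0 = X₀ ∧ ∀ t, 1 ≤ t → t ≤ T →
    (∃ j, X t j = r t) ∧
    ∀ Z : Fin k → Ω, (∃ j, Z j = r t) →
      optTo k X₀ r t (X t) + confDist (X t) (X (t - 1)) ≤
        optTo k X₀ r t Z + confDist Z (X (t - 1))
/-- The antipode `x̄ = x + Δ` of a point on the circle of circumference `2Δ`. -/
noncomputable def antip (Δ : ℝ) (x : AddCircle (2*Δ)) : AddCircle (2*Δ) := x + (Δ : ℝ)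

/-- The set `P`: triples of circle points not contained in any open semicircle,
i.e. with `d(x,y) + d(y,z) + d(z,x) = 2Δ`. -/
def InP (Δ : ℝ) (x y z : AddCircle (2*Δ)) : Prop :=
  dist x y + dist y z + dist z x = 2*Δ

/-- The potential `Φ*(w,u,x,y,z) = w(ū³) + w(u x ȳ) + w(u y z̄) + w(u z x̄)`. -/
noncomputable def PhiStar (Δ : ℝ) (w : (Fin 3 → AddCircle (2*Δ)) → ℝ)
    (u x y z : AddCircle (2*Δ)) : ℝ :=
  w ![antip Δ u, antip Δ u, antip Δ u] + w ![u, x, antip Δ y]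
    + w ![u, y, antip Δ z] + w ![u, z, antip Δ x]

/-- `w(X)` resolves from the `i`-th point of the configuration `X` (w.r.t. the
last request `r`): `w(X) = w(X - X i + r) + d(X i, r)`. -/
def ResolvesFrom {Ω : Type*} [MetricSpace Ω] (w : (Fin 3 → Ω) → ℝ) (r : Ω)
    (X : Fin 3 → Ω) (i : Fin 3) : Prop :=
  w X = w (Function.update X i r) + dist (X i) r

theorem confDist_nonneg {Ω : Type*} [MetricSpace Ω] {k : ℕ} (X Y : Fin k → Ω) :
    0 ≤ confDist X Y :=
  Real.iInf_nonneg fun _ => Finset.sum_nonneg fun _ _ => dist_nonneg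

theorem confDist_le_add_sum_dist {Ω : Type*} [MetricSpace Ω] {k : ℕ} (X Y Z : Fin k → Ω) :
    confDist X Z ≤ confDist X Y + ∑ i, dist (Y i) (Z i) := by
  rw [← sub_le_iff_le_add]
  refine le_ciInf fun σ => ?_
  rw [sub_le_iff_le_add, ← Equiv.sum_comp σ fun i => dist (Y i) (Z i), ← Finset.sum_add_distrib]
  exact (ciInf_le (Set.finite_range _).bddBelow σ).trans
    (Finset.sum_le_sum fun i _ => dist_triangle _ _ _)

/-- The work function is 1-Lipschitz with respect to pointwise movement of the servers. -/
theorem workFn_le_add_sum_dist {Ω : Type*} [MetricSpace Ω] {k : ℕ} (hk : 0 < k)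
    (X₀ : Fin k → Ω) (r : ℕ → Ω) (t : ℕ) (X Y : Fin k → Ω) :
    workFn k X₀ r t Y ≤ workFn k X₀ r t X + ∑ i, dist (X i) (Y i) := by
  rw [← sub_le_iff_le_add]
  refine le_csInf ?_ ?_
  · refine ⟨_, fun i => if i = 0 then X₀ else fun _ => r i, if_pos rfl,
      fun i hi => ⟨⟨0, hk⟩, ?_⟩, rfl⟩
    have hi0 : i ≠ 0 := Nat.one_le_iff_ne_zero.mp (Finset.mem_Icc.mp hi).1
    simp [hi0]
  · rintro c ⟨S, hS₀, hS, rfl⟩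
    rw [sub_le_iff_le_add, add_assoc]
    refine le_trans (csInf_le ⟨0, ?_⟩ ⟨S, hS₀, hS, rfl⟩)
      (add_le_add_right (confDist_le_add_sum_dist _ _ _) _)
    rintro c ⟨S', -, -, rfl⟩
    exact add_nonneg (Finset.sum_nonneg fun _ _ => confDist_nonneg _ _) (confDist_nonneg _ _)

/-- Case 0: if all of `w(u x ȳ)`, `w(u y z̄)`, `w(u z x̄)` resolve from `u`, then
`Φ*(w,u,x,y,z) ≥ Φ*(w,r,x,y,z)`. -/
theorem phiStar_case_all_resolve_from_u (Δ : ℝ) (hΔ : 0 < Δ)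
    (X₀ : Fin 3 → AddCircle (2*Δ)) (r : ℕ → AddCircle (2*Δ)) (T t : ℕ)
    (ht : 1 ≤ t) (htT : t ≤ T) (u x y z : AddCircle (2*Δ)) (hP : InP Δ x y z)
    (h1 : ResolvesFrom (workFn 3 X₀ r t) (r t) ![u, x, antip Δ y] 0)
    (h2 : ResolvesFrom (workFn 3 X₀ r t) (r t) ![u, y, antip Δ z] 0)
    (h3 : ResolvesFrom (workFn 3 X₀ r t) (r t) ![u, z, antip Δ x] 0) :
    PhiStar Δ (workFn 3 X₀ r t) (r t) x y z ≤
      PhiStar Δ (workFn 3 X₀ r t) u x y z := by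
  have hlip := workFn_le_add_sum_dist (by norm_num) X₀ r t
    ![antip Δ u, antip Δ u, antip Δ u] ![antip Δ (r t), antip Δ (r t), antip Δ (r t)]
  have hupd (a b : AddCircle (2*Δ)) : Function.update ![u, a, b] 0 (r t) = ![r t, a, b] := by
    ext i; fin_cases i <;> rfl
  have hdist : dist (antip Δ u) (antip Δ (r t)) = dist u (r t) := dist_add_right _ _ _
  simp only [ResolvesFrom, hupd, Matrix.cons_val_zero] at h1 h2 h3
  simp only [Fin.sum_univ_three, Matrix.cons_val, hdist] at hlip
  unfold PhiStar
  linarith
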